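/- Let n ≥ 1, m ≥ 1, s_1,…,s_m > 0 and λ = s_1 + ⋯ + s_m. (i) There is a constant C > 0 such that for every g ∈ A_λ^∞(ℝ^{n+1}_+) there exists a function f on (ℝ^{n+1}_+)^m which is harmonic on (ℝ^{n+1}_+)^m and harmonic in each variable z_j separately, satisfies f(z,…,z) = g(z) for all z ∈ ℝ^{n+1}_+, and sup_{z_1,…,z_m ∈ ℝ^{n+1}_+} |f(z_1,…,z_m)| t_1^{s_1}⋯t_m^{s_m} ≤ C ‖g‖_{A_λ^∞} (where z_j = (x_j,t_j)). (ii) Conversely, if f is a function on (ℝ^{n+1}_+)^m with sup |f(z_1,…,z_m)| t_1^{s_1}⋯t_m^{s_m} < ∞ and if z ↦ f(z,…,z) is harmonic on ℝ^{n+1}_+, then z ↦ f(z,…,z) belongs to A_λ^∞. -/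

import Mathlib

open MeasureTheory Real Set
open scoped ENNReal

noncomputable section

abbrev Euc (N : ℕ) : Type := EuclideanSpace ℝ (Fin N)

/-- The point `(x, t) ∈ ℝ^{n+1}`. -/
def pt {n : ℕ} (x : Euc n) (t : ℝ) : Euc (n + 1) :=
  (EuclideanSpace.equiv (Fin (n + 1)) ℝ).symm (Fin.snoc (fun i => x i) t)

/-- horizontal part of a point of ℝ^{n+1} -/
def xp {n : ℕ} (z : Euc (n + 1)) : Euc n :=
  (EuclideanSpace.equiv (Fin n) ℝ).symm (fun i => z i.castSucc)

/-- vertical part of a point of ℝ^{n+1} -/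
def tp {n : ℕ} (z : Euc (n + 1)) : ℝ := z (Fin.last n)

/-- The upper half space ℝ^{n+1}_+. -/
def upperHS (n : ℕ) : Set (Euc (n + 1)) := {z | 0 < tp z}

/-- |z - w̄| where z = (x,t), w̄ = (y, -s): Euclidean distance -/
def dB {n : ℕ} (x : Euc n) (t : ℝ) (y : Euc n) (s : ℝ) : ℝ :=
  dist (pt x t) (pt y (-s))

/-- the measure t^λ dx dt on ℝ^n × (0,∞), identified with ℝ^{n+1}_+ -/
def mLam (n : ℕ) (l : ℝ) : Measure (Euc n × ℝ) :=
  ((volume : Measure (Euc n)).prod ((volume : Measure ℝ).restrict (Ioi 0))).withDensity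
    (fun zt => ENNReal.ofReal (zt.2 ^ l))

/-- second derivative of `f` at `z` along direction `v` -/
def d2 {V : Type*} [NormedAddCommGroup V] [NormedSpace ℝ V] (f : V → ℝ) (z v : V) : ℝ :=
  iteratedFDeriv ℝ 2 f z ![v, v]

/-- `f` is harmonic on a subset of ℝ^N : twice continuously differentiable with
vanishing Laplacian. -/
def HarmonicOnE {N : ℕ} (f : Euc N → ℝ) (s : Set (Euc N)) : Prop :=
  ContDiffOn ℝ 2 f s ∧ ∀ z ∈ s, ∑ i, d2 f z (EuclideanSpace.single i 1) = 0

/-- `f` is harmonic on (ℝ^{n+1}_+)^m, viewed as an open subset of ℝ^{m(n+1)}. -/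
def HarmonicOnM {n m : ℕ} (f : (Fin m → Euc (n + 1)) → ℝ) : Prop :=
  ContDiffOn ℝ 2 f {z | ∀ j, z j ∈ upperHS n} ∧
  ∀ z ∈ {z : Fin m → Euc (n + 1) | ∀ j, z j ∈ upperHS n},
    ∑ j, ∑ i, d2 f z (Function.update (0 : Fin m → Euc (n + 1)) j (EuclideanSpace.single i 1)) = 0

/-- `f` is harmonic in each variable separately on (ℝ^{n+1}_+)^m -/
def HarmonicSep {n m : ℕ} (f : (Fin m → Euc (n + 1)) → ℝ) : Prop :=
  ∀ (j : Fin m) (z : Fin m → Euc (n + 1)), (∀ k, z k ∈ upperHS n) →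
    HarmonicOnE (fun w => f (Function.update z j w)) (upperHS n)

/-- the closed cube centered at (y,s) with side length s -/
def Qcube {n : ℕ} (y : Euc n) (s : ℝ) : Set (Euc (n + 1)) :=
  {z | (∀ i : Fin n, |z (Fin.castSucc i) - y i| ≤ s / 2) ∧ |tp z - s| ≤ s / 2}

/-- the A^p_λ (quasi)-norm, raised to the power p -/
def normAp (n : ℕ) (f : Euc (n + 1) → ℝ) (p l : ℝ) : ℝ≥0∞ :=
  ∫⁻ zt : Euc n × ℝ, ENNReal.ofReal (|f (pt zt.1 zt.2)| ^ p) ∂(mLam n l)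

/-- membership in the harmonic Bergman space A^p_λ -/
def memAp (n : ℕ) (f : Euc (n + 1) → ℝ) (p l : ℝ) : Prop :=
  HarmonicOnE f (upperHS n) ∧ normAp n f p l < ⊤


/-- the A^∞_λ norm sup_{(x,t)} t^λ |f(x,t)|, as an extended real -/
def supNormE (n : ℕ) (f : Euc (n + 1) → ℝ) (l : ℝ) : ℝ≥0∞ :=
  ⨆ (v : Euc n × ℝ) (_ : 0 < v.2), ENNReal.ofReal (v.2 ^ l * |f (pt v.1 v.2)|)

lemma pt_xp_tp {n : ℕ} (z : Euc (n + 1)) : pt (xp z) (tp z) = z := by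
  ext i
  refine Fin.lastCases ?_ (fun i => ?_) i <;> simp [pt, xp, tp]

lemma tp_pt {n : ℕ} (x : Euc n) (t : ℝ) : tp (pt x t) = t := by
  simp [pt, tp]

lemma isOpen_upperHS (n : ℕ) : IsOpen (upperHS n) :=
  isOpen_lt continuous_const (EuclideanSpace.proj (𝕜 := ℝ) (Fin.last n)).continuous

lemma ofReal_le_supNormE {n : ℕ} (g : Euc (n + 1) → ℝ) (l : ℝ) {z : Euc (n + 1)}
    (hz : z ∈ upperHS n) : ENNReal.ofReal (tp z ^ l * |g z|) ≤ supNormE n g l := by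
  have h := le_iSup₂ (f := fun (v : Euc n × ℝ) (_ : 0 < v.2) =>
    ENNReal.ofReal (v.2 ^ l * |g (pt v.1 v.2)|)) (xp z, tp z) hz
  rw [pt_xp_tp] at h
  exact h

section Affine

variable {V W : Type*} [NormedAddCommGroup V] [NormedSpace ℝ V]
  [NormedAddCommGroup W] [NormedSpace ℝ W]

lemma contDiffOn_comp_affine {g : V → ℝ} {s : Set V} {t : Set W} (hg : ContDiffOn ℝ 2 g s)
    (a : V) (L : W →L[ℝ] V) (ht : MapsTo (fun w => a + L w) t s) :
    ContDiffOn ℝ 2 (fun w => g (a + L w)) t :=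
  hg.comp (contDiff_const.add L.contDiff).contDiffOn ht

lemma d2_comp_affine {g : V → ℝ} {s : Set V} (hs : IsOpen s) (hg : ContDiffOn ℝ 2 g s)
    (a : V) (L : W →L[ℝ] V) {z : W} (hz : a + L z ∈ s) (v : W) :
    d2 (fun w => g (a + L w)) z v = d2 g (a + L z) (L v) := by
  have hs' : IsOpen ((fun y => a + y) ⁻¹' s) := hs.preimage (by fun_prop)
  have hs'' : IsOpen (L ⁻¹' ((fun y => a + y) ⁻¹' s)) := hs'.preimage L.continuous
  have hg' : ContDiffOn ℝ 2 (fun y => g (a + y)) ((fun y => a + y) ⁻¹' s) :=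
    hg.comp (contDiff_const.add contDiff_id).contDiffOn (mapsTo_preimage _ _)
  have h := L.iteratedFDerivWithin_comp_right (i := 2) hg' hs'.uniqueDiffOn hs''.uniqueDiffOn
    (x := z) hz (by norm_num)
  rw [iteratedFDerivWithin_of_isOpen 2 hs'' hz, iteratedFDerivWithin_of_isOpen 2 hs' hz,
    iteratedFDeriv_comp_add_left] at h
  have h' := congrArg (fun T => T ![v, v]) h
  refine h'.trans ?_
  simp only [d2, ContinuousMultilinearMap.compContinuousLinearMap_apply]
  congr 1
  ext i
  fin_cases i <;> rfl

lemma d2_smul (g : V → ℝ) (z v : V) (c : ℝ) : d2 g z (c • v) = c ^ 2 * d2 g z v := by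
  have h := (iteratedFDeriv ℝ 2 g z).map_smul_univ (fun _ => c) ![v, v]
  have e : (fun i => c • (![v, v] : Fin 2 → V) i) = ![c • v, c • v] := by
    ext i
    fin_cases i <;> rfl
  rw [e] at h
  simpa [d2] using h

end Affine

/-- The arithmetic mean of `m` points, as a continuous linear map. -/
def meanCLM (n m : ℕ) : (Fin m → Euc (n + 1)) →L[ℝ] Euc (n + 1) :=
  (m : ℝ)⁻¹ • ∑ j, ContinuousLinearMap.proj j

lemma meanCLM_apply {n m : ℕ} (z : Fin m → Euc (n + 1)) :
    meanCLM n m z = (m : ℝ)⁻¹ • ∑ j, z j := by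
  simp [meanCLM]

lemma tp_meanCLM {n m : ℕ} (z : Fin m → Euc (n + 1)) :
    tp (meanCLM n m z) = (m : ℝ)⁻¹ * ∑ j, tp (z j) := by
  simp [meanCLM_apply, tp]

lemma meanCLM_mem {n m : ℕ} (hm : 1 ≤ m) {z : Fin m → Euc (n + 1)}
    (hz : ∀ j, z j ∈ upperHS n) : meanCLM n m z ∈ upperHS n := by
  have : Nonempty (Fin m) := ⟨⟨0, hm⟩⟩
  have hm' : (0 : ℝ) < m := by exact_mod_cast hm
  change 0 < tp _
  rw [tp_meanCLM]
  exact mul_pos (inv_pos.2 hm') (Finset.sum_pos (fun j _ => hz j) Finset.univ_nonempty)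

lemma meanCLM_const {n m : ℕ} (hm : 1 ≤ m) (z : Euc (n + 1)) :
    meanCLM n m (fun _ => z) = z := by
  have hm' : (m : ℝ) ≠ 0 := by positivity
  rw [meanCLM_apply, Finset.sum_const, Finset.card_univ, Fintype.card_fin,
    ← Nat.cast_smul_eq_nsmul ℝ, smul_smul, inv_mul_cancel₀ hm', one_smul]

lemma meanCLM_update_zero {n m : ℕ} (j : Fin m) (w : Euc (n + 1)) :
    meanCLM n m (Function.update 0 j w) = (m : ℝ)⁻¹ • w := by
  rw [meanCLM_apply, Finset.sum_eq_single j]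
  · simp
  · intro k _ hk
    simp [hk]
  · simp

lemma meanCLM_update {n m : ℕ} (z : Fin m → Euc (n + 1)) (j : Fin m) (w : Euc (n + 1)) :
    meanCLM n m (Function.update z j w) =
      meanCLM n m (Function.update z j 0) + ((m : ℝ)⁻¹ • ContinuousLinearMap.id ℝ _) w := by
  have e : Function.update z j w = Function.update z j 0 + Function.update (0 : Fin m → Euc (n + 1)) j w := by
    rw [← Function.update_add, add_zero, zero_add]
  rw [e, map_add, meanCLM_update_zero]
  rfl

lemma HarmonicOnE.harmonicOnM_mean {n m : ℕ} (hm : 1 ≤ m) {g : Euc (n + 1) → ℝ}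
    (hg : HarmonicOnE g (upperHS n)) : HarmonicOnM (fun z => g (meanCLM n m z)) := by
  have e : (fun z => g (meanCLM n m z)) = fun z => g (0 + meanCLM n m z) := by simp
  refine ⟨hg.1.comp (meanCLM n m).contDiff.contDiffOn fun z hz => meanCLM_mem hm hz,
    fun z hz => Finset.sum_eq_zero fun j _ => ?_⟩
  have hz' := meanCLM_mem hm hz
  rw [e]
  simp_rw [d2_comp_affine (isOpen_upperHS n) hg.1 0 (meanCLM n m)
    (z := z) (by simpa using hz'), meanCLM_update_zero, d2_smul]
  rw [← Finset.mul_sum, zero_add, hg.2 _ hz', mul_zero]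

lemma HarmonicOnE.harmonicSep_mean {n m : ℕ} (hm : 1 ≤ m) {g : Euc (n + 1) → ℝ}
    (hg : HarmonicOnE g (upperHS n)) : HarmonicSep (fun z => g (meanCLM n m z)) := by
  intro j z hz
  have hmaps : ∀ w ∈ upperHS n, meanCLM n m (Function.update z j 0) +
      ((m : ℝ)⁻¹ • ContinuousLinearMap.id ℝ (Euc (n + 1))) w ∈ upperHS n := by
    intro w hw
    rw [← meanCLM_update]
    refine meanCLM_mem hm fun k => ?_
    by_cases hk : k = j
    · subst hk
      simpa using hw
    · simpa [hk] using hz k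
  rw [funext fun w => congrArg g (meanCLM_update z j w)]
  refine ⟨contDiffOn_comp_affine hg.1 _ _ hmaps, fun w hw => ?_⟩
  simp_rw [d2_comp_affine (isOpen_upperHS n) hg.1 _ _ (hmaps w hw)]
  change ∑ i, d2 g _ ((m : ℝ)⁻¹ • EuclideanSpace.single i (1 : ℝ)) = 0
  simp_rw [d2_smul]
  rw [← Finset.mul_sum, hg.2 _ (hmaps w hw), mul_zero]

lemma prod_rpow_le_mean {n m : ℕ} (hm : 1 ≤ m) {s : Fin m → ℝ} (hs : ∀ j, 0 < s j)
    {z : Fin m → Euc (n + 1)} (hz : ∀ j, z j ∈ upperHS n) :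
    ∏ j, tp (z j) ^ s j ≤ (m : ℝ) ^ (∑ j, s j) * tp (meanCLM n m z) ^ (∑ j, s j) := by
  have hm' : (0 : ℝ) < m := by exact_mod_cast hm
  have hmean : 0 < tp (meanCLM n m z) := meanCLM_mem hm hz
  rw [← Real.mul_rpow hm'.le hmean.le, Real.rpow_sum_of_pos (mul_pos hm' hmean)]
  refine Finset.prod_le_prod (fun j _ => Real.rpow_nonneg (hz j).le _) fun j _ =>
    Real.rpow_le_rpow (hz j).le ?_ (hs j).le
  rw [tp_meanCLM, mul_inv_cancel_left₀ hm'.ne']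
  exact Finset.single_le_sum (f := fun j => tp (z j)) (fun k _ => (hz k).le) (Finset.mem_univ j)

/-- traces of the spaces A^∞ on the polydomain (ℝ^{n+1}_+)^m. -/
theorem stmt5 (n m : ℕ) (hn : 1 ≤ n) (hm : 1 ≤ m)
    (s : Fin m → ℝ) (hs : ∀ j, 0 < s j) (lam : ℝ) (hlam : lam = ∑ j, s j) :
    (∃ C : ℝ, 0 < C ∧ ∀ g : Euc (n + 1) → ℝ,
      HarmonicOnE g (upperHS n) → supNormE n g lam < ⊤ →
      ∃ f : (Fin m → Euc (n + 1)) → ℝ, HarmonicOnM f ∧ HarmonicSep f ∧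
        (∀ z ∈ upperHS n, f (fun _ => z) = g z) ∧
        (∀ z : Fin m → Euc (n + 1), (∀ j, z j ∈ upperHS n) →
          ENNReal.ofReal (|f z| * ∏ j, (tp (z j)) ^ s j) ≤
            ENNReal.ofReal C * supNormE n g lam)) ∧
    (∀ f : (Fin m → Euc (n + 1)) → ℝ,
      (∃ M : ℝ, ∀ z : Fin m → Euc (n + 1), (∀ j, z j ∈ upperHS n) →
          |f z| * ∏ j, (tp (z j)) ^ s j ≤ M) →
      HarmonicOnE (fun z => f (fun _ => z)) (upperHS n) →
      supNormE n (fun z => f (fun _ => z)) lam < ⊤) := by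
  subst hlam
  have hm' : (0 : ℝ) < m := by exact_mod_cast hm
  refine ⟨⟨(m : ℝ) ^ (∑ j, s j), Real.rpow_pos_of_pos hm' _, fun g hg _ =>
    ⟨fun z => g (meanCLM n m z), hg.harmonicOnM_mean hm, hg.harmonicSep_mean hm,
      fun z _ => congrArg g (meanCLM_const hm z), fun z hz => ?_⟩⟩, ?_⟩
  · refine le_trans (ENNReal.ofReal_le_ofReal ?_)
      ((ENNReal.ofReal_mul (Real.rpow_nonneg hm'.le _)).trans_le
        (mul_le_mul_right (ofReal_le_supNormE g _ (meanCLM_mem hm hz)) _))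
    calc |g (meanCLM n m z)| * ∏ j, tp (z j) ^ s j
        ≤ |g (meanCLM n m z)| * ((m : ℝ) ^ (∑ j, s j) * tp (meanCLM n m z) ^ (∑ j, s j)) :=
          mul_le_mul_of_nonneg_left (prod_rpow_le_mean hm hs hz) (abs_nonneg _)
      _ = _ := by ring
  · rintro f ⟨M, hM⟩ _
    refine lt_of_le_of_lt (iSup₂_le fun v hv => ENNReal.ofReal_le_ofReal ?_)
      (ENNReal.ofReal_lt_top (r := M))
    have h := hM (fun _ => pt v.1 v.2) fun _ => by simpa [upperHS, tp_pt] using hv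
    rw [mul_comm, Real.rpow_sum_of_pos hv]
    simpa only [tp_pt] using h

end
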